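/- Let k ≥ 3 be an integer. A digraph D has dichromatic number χ⃗(D) ≥ k if and only if D contains an Ore-k-constructible subdigraph. -/

import Mathlib

/-- A finite digraph on the vertex type `ℕ`: a finite vertex set together with a
finite set of arcs (ordered pairs of vertices), loopless, without parallel arcs
(but opposite arcs between two vertices are allowed). -/
structure Digr where
  verts : Finset ℕ
  arcs : Finset (ℕ × ℕ)
  arcs_sub : ∀ a ∈ arcs, a.1 ∈ verts ∧ a.2 ∈ verts
  no_loops : ∀ a ∈ arcs, a.1 ≠ a.2

namespace Digr

/-- `D'` is a subdigraph of `D`. -/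
def Sub (D' D : Digr) : Prop := D'.verts ⊆ D.verts ∧ D'.arcs ⊆ D.arcs

/-- An acyclic coloring of `D` with `n` colors: no directed cycle is monochromatic.
A monochromatic directed cycle through `v` is exactly a nontrivial closed walk from `v`
to `v` along arcs whose endpoints always get equal colors. -/
def GoodColoring (D : Digr) (n : ℕ) (φ : ℕ → Fin n) : Prop :=
  ∀ v, ¬ Relation.TransGen (fun x y => (x, y) ∈ D.arcs ∧ φ x = φ y) v v

/-- `D` admits an acyclic coloring with `n` colors. -/
def Colorable (D : Digr) (n : ℕ) : Prop := ∃ φ : ℕ → Fin n, D.GoodColoring n φ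

/-- The dichromatic number of `D`. -/
noncomputable def dichrom (D : Digr) : ℕ := sInf {n | D.Colorable n}

/-- `D` is `k`-critical: its dichromatic number is `k` and every proper subdigraph
has smaller dichromatic number. -/
def Critical (k : ℕ) (D : Digr) : Prop :=
  D.dichrom = k ∧ ∀ D' : Digr, D'.Sub D → D' ≠ D → D'.dichrom < k

/-- Deletion of a vertex. -/
def delete (D : Digr) (v : ℕ) : Digr where
  verts := D.verts.erase v
  arcs := D.arcs.filter (fun a => a.1 ≠ v ∧ a.2 ≠ v)
  arcs_sub := by
    intro a ha
    rw [Finset.mem_filter] at ha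
    obtain ⟨ha, h1, h2⟩ := ha
    have h := D.arcs_sub a ha
    exact ⟨Finset.mem_erase.mpr ⟨h1, h.1⟩, Finset.mem_erase.mpr ⟨h2, h.2⟩⟩
  no_loops := fun a ha => D.no_loops a (Finset.mem_filter.mp ha).1

/-- The subdigraph of `D` induced by a set `S` of vertices. -/
def induce (D : Digr) (S : Finset ℕ) : Digr where
  verts := D.verts ∩ S
  arcs := D.arcs.filter (fun a => a.1 ∈ S ∧ a.2 ∈ S)
  arcs_sub := by
    intro a ha
    rw [Finset.mem_filter] at ha
    obtain ⟨ha, h1, h2⟩ := ha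
    have h := D.arcs_sub a ha
    exact ⟨Finset.mem_inter.mpr ⟨h.1, h1⟩, Finset.mem_inter.mpr ⟨h.2, h2⟩⟩
  no_loops := fun a ha => D.no_loops a (Finset.mem_filter.mp ha).1

/-- Out-neighborhood of `v` in `D`. -/
def outNbrs (D : Digr) (v : ℕ) : Finset ℕ := D.verts.filter (fun y => (v, y) ∈ D.arcs)

/-- In-neighborhood of `v` in `D`. -/
def inNbrs (D : Digr) (v : ℕ) : Finset ℕ := D.verts.filter (fun x => (x, v) ∈ D.arcs)

/-- Out-degree. -/
def outDeg (D : Digr) (v : ℕ) : ℕ := (D.outNbrs v).card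

/-- In-degree. -/
def inDeg (D : Digr) (v : ℕ) : ℕ := (D.inNbrs v).card

/-- `D` is (weakly) connected, i.e. its underlying graph is connected. -/
def Conn (D : Digr) : Prop :=
  ∀ x ∈ D.verts, ∀ y ∈ D.verts,
    Relation.ReflTransGen (fun a b => (a, b) ∈ D.arcs ∨ (b, a) ∈ D.arcs) x y

/-- `D` is strongly connected. -/
def StronglyConn (D : Digr) : Prop :=
  ∀ x ∈ D.verts, ∀ y ∈ D.verts,
    Relation.ReflTransGen (fun a b => (a, b) ∈ D.arcs) x y

/-- `H` has no separating vertex. -/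
def NoSepVertex (H : Digr) : Prop := ∀ v ∈ H.verts, (H.delete v).Conn

/-- `B` is a block of `D`: a maximal connected subdigraph of `D` without a
separating vertex. -/
def IsBlock (B D : Digr) : Prop :=
  B.Sub D ∧ B.Conn ∧ B.NoSepVertex ∧
    ∀ B' : Digr, B'.Sub D → B'.Conn → B'.NoSepVertex → B.Sub B' → B' = B

/-- `B` is a directed cycle (of length ≥ 2). -/
def IsDirCycle (B : Digr) : Prop :=
  ∃ (n : ℕ) (f : ℕ → ℕ), 2 ≤ n ∧ Set.InjOn f ↑(Finset.range n) ∧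
    B.verts = (Finset.range n).image f ∧
    B.arcs = (Finset.range n).image (fun i => (f i, f ((i + 1) % n)))

/-- `B` is a bidirected cycle of length `n`. -/
def IsBidirCycle (B : Digr) (n : ℕ) : Prop :=
  ∃ f : ℕ → ℕ, Set.InjOn f ↑(Finset.range n) ∧
    B.verts = (Finset.range n).image f ∧
    B.arcs = (Finset.range n).image (fun i => (f i, f ((i + 1) % n))) ∪
      (Finset.range n).image (fun i => (f ((i + 1) % n), f i))

/-- `B` is a bidirected complete graph: every ordered pair of distinct vertices is an arc. -/
def IsBidirComplete (B : Digr) : Prop :=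
  B.arcs = (B.verts ×ˢ B.verts).filter (fun a => a.1 ≠ a.2)

/-- `D` contains a bidirected complete graph on `k` vertices as a subdigraph. -/
def ContainsK (k : ℕ) (D : Digr) : Prop :=
  ∃ S : Finset ℕ, S ⊆ D.verts ∧ S.card = k ∧
    ∀ x ∈ S, ∀ y ∈ S, x ≠ y → (x, y) ∈ D.arcs

/-- `D` is the Dirac join of the disjoint digraphs `D1` and `D2`: their union
together with all arcs in both directions between them. -/
def IsDiracJoin (D D1 D2 : Digr) : Prop :=
  Disjoint D1.verts D2.verts ∧
  D.verts = D1.verts ∪ D2.verts ∧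
  D.arcs = D1.arcs ∪ D2.arcs ∪ D1.verts ×ˢ D2.verts ∪ D2.verts ×ˢ D1.verts

/-- `D` is the directed Hajós join `(D1, v1, u1) ▽ (D2, v2, u2)` of the disjoint
digraphs `D1` and `D2`: delete the arcs `u1v1` and `v2u2`, identify `v1` and `v2`
(the merged vertex is represented by `v1`), and add the arc `u1u2`. -/
def IsHajosJoin (D D1 D2 : Digr) (u1 v1 v2 u2 : ℕ) : Prop :=
  Disjoint D1.verts D2.verts ∧
  (u1, v1) ∈ D1.arcs ∧ (v2, u2) ∈ D2.arcs ∧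
  D.verts = D1.verts ∪ D2.verts.erase v2 ∧
  D.arcs = D1.arcs.erase (u1, v1) ∪
      (D2.arcs.erase (v2, u2)).image
        (Prod.map (fun x => if x = v2 then v1 else x) (fun x => if x = v2 then v1 else x)) ∪
      {(u1, u2)}

/-- `D` is the bidirected Hajós join `(D1, v1, u1) ▽̄ (D2, v2, u2)` of the disjoint
digraphs `D1` and `D2`: delete both arcs of the digon between `u1` and `v1` and both
arcs of the digon between `u2` and `v2`, identify `v1` and `v2` (the merged vertex is
represented by `v1`), and add both arcs `u1u2` and `u2u1`. -/
def IsBidirHajosJoin (D D1 D2 : Digr) (u1 v1 v2 u2 : ℕ) : Prop :=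
  Disjoint D1.verts D2.verts ∧
  (u1, v1) ∈ D1.arcs ∧ (v1, u1) ∈ D1.arcs ∧
  (u2, v2) ∈ D2.arcs ∧ (v2, u2) ∈ D2.arcs ∧
  D.verts = D1.verts ∪ D2.verts.erase v2 ∧
  D.arcs = ((D1.arcs.erase (u1, v1)).erase (v1, u1)) ∪
      (((D2.arcs.erase (v2, u2)).erase (u2, v2)).image
        (Prod.map (fun x => if x = v2 then v1 else x) (fun x => if x = v2 then v1 else x))) ∪
      {(u1, u2), (u2, u1)}

/-- `D'` is obtained from `D` by identifying the non-empty independent set `I`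
with the (new) vertex `v`. -/
def IsIdent (D' D : Digr) (I : Finset ℕ) (v : ℕ) : Prop :=
  I.Nonempty ∧ I ⊆ D.verts ∧
  (∀ x ∈ I, ∀ y ∈ I, (x, y) ∉ D.arcs) ∧
  (v ∈ I ∨ v ∉ D.verts) ∧
  D'.verts = (D.verts \ I) ∪ {v} ∧
  D'.arcs = D.arcs.filter (fun a => a.1 ∉ I ∧ a.2 ∉ I) ∪
      (D.arcs.filter (fun a => a.1 ∈ I ∧ a.2 ∉ I)).image (fun a => (v, a.2)) ∪
      (D.arcs.filter (fun a => a.1 ∉ I ∧ a.2 ∈ I)).image (fun a => (a.1, v))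

/-- Isomorphism of digraphs. -/
def Iso (D D' : Digr) : Prop :=
  ∃ f : ℕ → ℕ, Set.BijOn f ↑D.verts ↑D'.verts ∧
    ∀ x ∈ D.verts, ∀ y ∈ D.verts, ((x, y) ∈ D.arcs ↔ (f x, f y) ∈ D'.arcs)

/-- The Hajós-`k`-constructible digraphs: the smallest family of digraphs (closed
under isomorphism) containing the bidirected complete graph on `k` vertices and
closed under directed Hajós joins and identification of independent sets. -/
inductive HajosConstr (k : ℕ) : Digr → Prop
  | base (D : Digr) : D.verts.card = k → D.IsBidirComplete → HajosConstr k D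
  | join (D D1 D2 : Digr) (u1 v1 v2 u2 : ℕ) :
      HajosConstr k D1 → HajosConstr k D2 →
      IsHajosJoin D D1 D2 u1 v1 v2 u2 → HajosConstr k D
  | ident (D' D : Digr) (I : Finset ℕ) (v : ℕ) :
      HajosConstr k D → IsIdent D' D I v → HajosConstr k D'
  | iso (D D' : Digr) : HajosConstr k D → Iso D D' → HajosConstr k D'

/-- `D` is a directed Ore join of the disjoint digraphs `D1` and `D2`: a directed
Hajós join followed by identifying each `w` in a set `A1 ⊆ V(D1 - v1)` with `ι w`,
where `ι` is a bijection from `A1` onto a subset of `V(D2 - v2)` with `ι u1 ≠ u2`. -/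
def IsOreJoin (D D1 D2 : Digr) (u1 v1 v2 u2 : ℕ) : Prop :=
  ∃ (H : Digr) (A1 : Finset ℕ) (ι : ℕ → ℕ),
    IsHajosJoin H D1 D2 u1 v1 v2 u2 ∧
    A1 ⊆ D1.verts.erase v1 ∧
    A1.image ι ⊆ D2.verts.erase v2 ∧
    Set.InjOn ι ↑A1 ∧
    (u1 ∈ A1 → ι u1 ≠ u2) ∧
    D.verts = H.verts.image (fun x => if x ∈ A1 then ι x else x) ∧
    D.arcs = H.arcs.image
      (Prod.map (fun x => if x ∈ A1 then ι x else x) (fun x => if x ∈ A1 then ι x else x))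

/-- `D` is a bidirected Ore join of the disjoint digraphs `D1` and `D2`: a bidirected
Hajós join followed by the same kind of identification as in the directed Ore join. -/
def IsBidirOreJoin (D D1 D2 : Digr) (u1 v1 v2 u2 : ℕ) : Prop :=
  ∃ (H : Digr) (A1 : Finset ℕ) (ι : ℕ → ℕ),
    IsBidirHajosJoin H D1 D2 u1 v1 v2 u2 ∧
    A1 ⊆ D1.verts.erase v1 ∧
    A1.image ι ⊆ D2.verts.erase v2 ∧
    Set.InjOn ι ↑A1 ∧
    (u1 ∈ A1 → ι u1 ≠ u2) ∧
    D.verts = H.verts.image (fun x => if x ∈ A1 then ι x else x) ∧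
    D.arcs = H.arcs.image
      (Prod.map (fun x => if x ∈ A1 then ι x else x) (fun x => if x ∈ A1 then ι x else x))

/-- The Ore-`k`-constructible digraphs: the smallest family of digraphs (closed under
isomorphism) containing the bidirected complete graph on `k` vertices and closed
under directed and bidirected Ore joins. -/
inductive OreConstr (k : ℕ) : Digr → Prop
  | base (D : Digr) : D.verts.card = k → D.IsBidirComplete → OreConstr k D
  | dirJoin (D D1 D2 : Digr) (u1 v1 v2 u2 : ℕ) :
      OreConstr k D1 → OreConstr k D2 →
      IsOreJoin D D1 D2 u1 v1 v2 u2 → OreConstr k D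
  | bidirJoin (D D1 D2 : Digr) (u1 v1 v2 u2 : ℕ) :
      OreConstr k D1 → OreConstr k D2 →
      IsBidirOreJoin D D1 D2 u1 v1 v2 u2 → OreConstr k D
  | iso (D D' : Digr) : OreConstr k D → Iso D D' → OreConstr k D'

/-- The set of low vertices of `D` (for the parameter `k`): the vertices with
out-degree and in-degree both equal to `k - 1`. -/
def lowVerts (D : Digr) (k : ℕ) : Finset ℕ :=
  D.verts.filter (fun v => D.outDeg v = k - 1 ∧ D.inDeg v = k - 1)

end Digr

namespace Digr

/-- Dilworth's theorem for finite subsets of a preorder (Galvin's proof). -/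
theorem dilworth_aux {α : Type} [DecidableEq α] [Preorder α] (n : ℕ) :
    ∀ S : Finset α, S.card = n → ∃ m : ℕ,
      (∃ T : Finset α, T ⊆ S ∧ T.card = m ∧ ∀ x ∈ T, ∀ y ∈ T, x ≠ y → ¬ x ≤ y) ∧
      ∃ φ : α → ℕ, (∀ x ∈ S, φ x < m) ∧
        ∀ x ∈ S, ∀ y ∈ S, φ x = φ y → x ≤ y ∨ y ≤ x := by
  classical
  induction n using Nat.strong_induction_on with
  | _ n ih =>
  intro S hS
  rcases S.eq_empty_or_nonempty with rfl | hne
  · exact ⟨0, ⟨∅, by simp⟩, fun _ => 0, by simp⟩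
  obtain ⟨a, ha, hamax⟩ := S.exists_maximal hne
  have hcard : (S.erase a).card < n := by
    rw [← hS]; exact Finset.card_erase_lt_of_mem ha
  obtain ⟨m, ⟨T, hTS, hTm, hT⟩, φ, hφ, hch⟩ := ih _ hcard (S.erase a) rfl
  -- antichains of size m in S.erase a
  let AC : Finset α → Prop := fun T => T ⊆ S.erase a ∧ T.card = m ∧
    ∀ x ∈ T, ∀ y ∈ T, x ≠ y → ¬ x ≤ y
  have hmeet : ∀ B, AC B → ∀ i < m, ∃ y ∈ B, φ y = i := by
    rintro B ⟨hBS, hBm, hB⟩ i hi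
    have hinj : Set.InjOn φ (B : Set α) := by
      intro x hx y hy hxy
      by_contra hne
      rcases hch x (hBS hx) y (hBS hy) hxy with h | h
      · exact hB x hx y hy hne h
      · exact hB y hy x hx (Ne.symm hne) h
    have himg : B.image φ = Finset.range m := by
      apply Finset.eq_of_subset_of_card_le
      · intro j hj
        obtain ⟨x, hx, rfl⟩ := Finset.mem_image.mp hj
        exact Finset.mem_range.mpr (hφ x (hBS hx))
      · rw [Finset.card_image_of_injOn hinj, hBm, Finset.card_range]
    have : i ∈ B.image φ := by rw [himg]; exact Finset.mem_range.mpr hi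
    obtain ⟨y, hy, h⟩ := Finset.mem_image.mp this
    exact ⟨y, hy, h⟩
  have hx : ∀ i, i < m → ∃ x ∈ S.erase a, φ x = i ∧ (∃ B, AC B ∧ x ∈ B) ∧
      ∀ y ∈ S.erase a, φ y = i → (∃ B, AC B ∧ y ∈ B) → y ≤ x := by
    intro i hi
    let P := (S.erase a).filter (fun x => φ x = i ∧ ∃ B, AC B ∧ x ∈ B)
    have hP : P.Nonempty := by
      obtain ⟨y, hy, hyi⟩ := hmeet T ⟨hTS, hTm, hT⟩ i hi
      exact ⟨y, Finset.mem_filter.mpr ⟨hTS hy, hyi, T, ⟨hTS, hTm, hT⟩, hy⟩⟩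
    obtain ⟨x, hxP, hxmax⟩ := P.exists_maximal hP
    obtain ⟨hxS, hxi, hxB⟩ := Finset.mem_filter.mp hxP
    refine ⟨x, hxS, hxi, hxB, fun y hyS hyi hyB => ?_⟩
    rcases hch x hxS y hyS (hxi.trans hyi.symm) with h | h
    · exact hxmax (Finset.mem_filter.mpr ⟨hyS, hyi, hyB⟩) h
    · exact h
  haveI : Nonempty α := ⟨a⟩
  choose! X hXS hXi hXB hXmax using hx
  have hanti : ∀ i < m, ∀ j < m, i ≠ j → ¬ X j ≤ X i := by
    intro i hi j hj hij hle
    obtain ⟨B, hB, hxB⟩ := hXB i hi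
    obtain ⟨y, hyB, hyj⟩ := hmeet B hB j hj
    have h1 : y ≤ X j := hXmax j hj y (hB.1 hyB) hyj ⟨B, hB, hyB⟩
    refine hB.2.2 y hyB (X i) hxB ?_ (h1.trans hle)
    rintro rfl
    exact hij ((hXi i hi).symm.trans hyj)
  by_cases hcase : ∃ i < m, X i ≤ a
  · obtain ⟨i, hi, hle⟩ := hcase
    let K := S.filter (fun z => z = a ∨ (φ z = i ∧ z ≤ X i))
    have haK : a ∈ K := Finset.mem_filter.mpr ⟨ha, Or.inl rfl⟩
    have hKc : (S \ K).card < n := by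
      rw [← hS]
      apply Finset.card_lt_card
      refine ⟨Finset.sdiff_subset, fun h => ?_⟩
      exact (Finset.mem_sdiff.mp (h ha)).2 haK
    obtain ⟨m', ⟨T', hT'S, hT'm, hT'⟩, φ', hφ', hch'⟩ := ih _ hKc (S \ K) rfl
    have hlt : m' < m := by
      by_contra hge
      push Not at hge
      obtain ⟨B, hBT, hBm⟩ := Finset.exists_subset_card_eq (hT'm.symm ▸ hge : m ≤ T'.card)
      have hBAC : AC B := by
        refine ⟨fun x hx => ?_, hBm, fun x hx y hy => hT' x (hBT hx) y (hBT hy)⟩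
        have := Finset.mem_sdiff.mp (hT'S (hBT hx))
        refine Finset.mem_erase.mpr ⟨?_, this.1⟩
        rintro rfl
        exact this.2 haK
      obtain ⟨y, hyB, hyi⟩ := hmeet B hBAC i hi
      have hyle := hXmax i hi y (hBAC.1 hyB) hyi ⟨B, hBAC, hyB⟩
      have := Finset.mem_sdiff.mp (hT'S (hBT hyB))
      exact this.2 (Finset.mem_filter.mpr ⟨this.1, Or.inr ⟨hyi, hyle⟩⟩)
    refine ⟨m, ⟨T, hTS.trans (Finset.erase_subset _ _), hTm, hT⟩,
      fun x => if x ∈ K then m' else φ' x, ?_, ?_⟩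
    · intro x hx
      by_cases hxK : x ∈ K
      · simp only [hxK, if_true]; exact hlt
      · simp only [hxK, if_false]
        exact (hφ' x (Finset.mem_sdiff.mpr ⟨hx, hxK⟩)).trans hlt
    · intro x hx y hy hxy
      by_cases hxK : x ∈ K <;> by_cases hyK : y ∈ K
      · obtain ⟨_, hx'⟩ := Finset.mem_filter.mp hxK
        obtain ⟨_, hy'⟩ := Finset.mem_filter.mp hyK
        by_cases hxa : x = a
        · rcases hy' with rfl | ⟨_, h⟩
          · subst hxa; exact Or.inl le_rfl
          · subst hxa; exact Or.inr (h.trans hle)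
        · rcases hx' with h | ⟨hxi, hxl⟩
          · exact absurd h hxa
          · by_cases hya : y = a
            · subst hya; exact Or.inl (hxl.trans hle)
            · rcases hy' with h | ⟨hyi, hyl⟩
              · exact absurd h hya
              · exact hch x (Finset.mem_erase.mpr ⟨hxa, hx⟩) y
                  (Finset.mem_erase.mpr ⟨hya, hy⟩) (hxi.trans hyi.symm)
      · simp only [hxK, hyK, if_true, if_false] at hxy
        have := hφ' y (Finset.mem_sdiff.mpr ⟨hy, hyK⟩)
        omega
      · simp only [hxK, hyK, if_true, if_false] at hxy
        have := hφ' x (Finset.mem_sdiff.mpr ⟨hx, hxK⟩)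
        omega
      · simp only [hxK, hyK, if_false] at hxy
        exact hch' x (Finset.mem_sdiff.mpr ⟨hx, hxK⟩) y (Finset.mem_sdiff.mpr ⟨hy, hyK⟩) hxy
  · push Not at hcase
    have hXinj : Set.InjOn X (Finset.range m : Set ℕ) := by
      intro i hi j hj hij
      have hi' := Finset.mem_range.mp hi
      have hj' := Finset.mem_range.mp hj
      rw [← hXi i hi', ← hXi j hj', hij]
    have hanot : a ∉ (Finset.range m).image X := by
      intro h
      obtain ⟨i, hi, h⟩ := Finset.mem_image.mp h
      exact hcase i (Finset.mem_range.mp hi) h.le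
    refine ⟨m + 1, ⟨insert a ((Finset.range m).image X), ?_, ?_, ?_⟩,
      fun x => if x = a then m else φ x, ?_, ?_⟩
    · intro x hx
      rcases Finset.mem_insert.mp hx with rfl | hx
      · exact ha
      · obtain ⟨i, hi, rfl⟩ := Finset.mem_image.mp hx
        exact Finset.mem_of_mem_erase (hXS i (Finset.mem_range.mp hi))
    · rw [Finset.card_insert_of_notMem hanot, Finset.card_image_of_injOn hXinj,
        Finset.card_range]
    · intro x hx y hy hne hle
      rcases Finset.mem_insert.mp hx with rfl | hx
      · rcases Finset.mem_insert.mp hy with rfl | hy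
        · exact hne rfl
        · obtain ⟨i, hi, rfl⟩ := Finset.mem_image.mp hy
          have hi := Finset.mem_range.mp hi
          exact hcase i hi (hamax (Finset.mem_of_mem_erase (hXS i hi)) hle)
      · obtain ⟨i, hi, rfl⟩ := Finset.mem_image.mp hx
        have hi := Finset.mem_range.mp hi
        rcases Finset.mem_insert.mp hy with rfl | hy
        · exact hcase i hi hle
        · obtain ⟨j, hj, rfl⟩ := Finset.mem_image.mp hy
          have hj := Finset.mem_range.mp hj
          exact hanti j hj i hi (fun h => hne (h ▸ rfl)) hle
    · intro x hx
      by_cases hxa : x = a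
      · simp [hxa]
      · simp only [hxa, if_false]
        exact (hφ x (Finset.mem_erase.mpr ⟨hxa, hx⟩)).trans (Nat.lt_succ_self m)
    · intro x hx y hy hxy
      by_cases hxa : x = a <;> by_cases hya : y = a
      · subst hxa; subst hya; exact Or.inl le_rfl
      · simp only [hxa, hya, if_true, if_false] at hxy
        have := hφ y (Finset.mem_erase.mpr ⟨hya, hy⟩)
        omega
      · simp only [hxa, hya, if_true, if_false] at hxy
        have := hφ x (Finset.mem_erase.mpr ⟨hxa, hx⟩)
        omega
      · simp only [hxa, hya, if_false] at hxy
        exact hch x (Finset.mem_erase.mpr ⟨hxa, hx⟩) y (Finset.mem_erase.mpr ⟨hya, hy⟩) hxy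

theorem transGen_lift_map {r p : ℕ → ℕ → Prop} (f : ℕ → ℕ)
    (h : ∀ x y, r x y → p (f x) (f y)) {a b : ℕ} (hab : Relation.TransGen r a b) :
    Relation.TransGen p (f a) (f b) := by
  induction hab with
  | single hs => exact .single (h _ _ hs)
  | tail _ hs ih => exact .tail ih (h _ _ hs)

theorem reflTransGen_lift_map {r p : ℕ → ℕ → Prop} (f : ℕ → ℕ)
    (h : ∀ x y, r x y → p (f x) (f y)) {a b : ℕ} (hab : Relation.ReflTransGen r a b) :
    Relation.ReflTransGen p (f a) (f b) := by
  induction hab with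
  | refl => exact .refl
  | tail _ hs ih => exact .tail ih (h _ _ hs)

/-- Colorings pull back along maps preserving arcs. -/
theorem colorable_of_hom {E D : Digr} {n : ℕ} (f : ℕ → ℕ)
    (hf : ∀ x y, (x, y) ∈ E.arcs → (f x, f y) ∈ D.arcs) (h : D.Colorable n) :
    E.Colorable n := by
  obtain ⟨φ, hφ⟩ := h
  refine ⟨φ ∘ f, fun v hv => hφ (f v) ?_⟩
  exact transGen_lift_map f (fun x y hxy => ⟨hf x y hxy.1, hxy.2⟩) hv

theorem transGen_split {r r' : ℕ → ℕ → Prop} (a b : ℕ)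
    (h : ∀ x y, r' x y → r x y ∨ (x = a ∧ y = b)) {x y : ℕ}
    (hxy : Relation.TransGen r' x y) :
    Relation.TransGen r x y ∨
      (r' a b ∧ Relation.ReflTransGen r x a ∧ Relation.ReflTransGen r b y) := by
  induction hxy with
  | single hs =>
    rcases h _ _ hs with h1 | ⟨rfl, rfl⟩
    · exact Or.inl (.single h1)
    · exact Or.inr ⟨hs, .refl, .refl⟩
  | tail _ hs ih =>
    rcases h _ _ hs with h1 | ⟨rfl, rfl⟩
    · rcases ih with ih | ⟨h0, h2, h3⟩
      · exact Or.inl (ih.tail h1)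
      · exact Or.inr ⟨h0, h2, h3.tail h1⟩
    · rcases ih with ih | ⟨h0, h2, h3⟩
      · exact Or.inr ⟨hs, ih.to_reflTransGen, .refl⟩
      · exact Or.inr ⟨hs, h2, .refl⟩

theorem half_dir {E D : Digr} {n : ℕ} {φ : ℕ → Fin n} (f : ℕ → ℕ) (a b : ℕ)
    (hE : ¬ E.Colorable n) (hφ : D.GoodColoring n φ)
    (hf : ∀ x y, (x, y) ∈ E.arcs → (x, y) ≠ (a, b) → (f x, f y) ∈ D.arcs) :
    φ (f a) = φ (f b) ∧
      Relation.ReflTransGen (fun x y => (x, y) ∈ D.arcs ∧ φ x = φ y) (f b) (f a) := by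
  have : ¬ E.GoodColoring n (φ ∘ f) := fun h => hE ⟨_, h⟩
  unfold GoodColoring at this
  push Not at this
  obtain ⟨v, hv⟩ := this
  have key := transGen_split (r := fun x y => (f x, f y) ∈ D.arcs ∧ φ (f x) = φ (f y)) a b
    (fun x y hxy => by
      by_cases hab : (x, y) = (a, b)
      · right; simpa using hab
      · left; exact ⟨hf x y hxy.1 hab, hxy.2⟩) hv
  rcases key with h | ⟨h0, h1, h2⟩
  · exact absurd (transGen_lift_map f (fun x y h => h) h) (hφ (f v))
  · exact ⟨h0.2, reflTransGen_lift_map f (fun x y h => h) (h2.trans h1)⟩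

theorem half_bidir {E D : Digr} {n : ℕ} {φ : ℕ → Fin n} (f : ℕ → ℕ) (a b : ℕ)
    (hE : ¬ E.Colorable n) (hφ : D.GoodColoring n φ)
    (hf : ∀ x y, (x, y) ∈ E.arcs → (x, y) ≠ (a, b) → (x, y) ≠ (b, a) →
      (f x, f y) ∈ D.arcs) :
    φ (f a) = φ (f b) := by
  by_contra hne
  refine hE ⟨φ ∘ f, fun v hv => hφ (f v) ?_⟩
  refine transGen_lift_map f (fun x y hxy => ⟨hf x y hxy.1 ?_ ?_, hxy.2⟩) hv
  · intro h
    obtain ⟨rfl, rfl⟩ := Prod.mk.inj h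
    exact hne hxy.2
  · intro h
    obtain ⟨rfl, rfl⟩ := Prod.mk.inj h
    exact hne hxy.2.symm

theorem oreConstr_not_colorable {k n : ℕ} (hn : n < k) {D : Digr} (h : OreConstr k D) :
    ¬ D.Colorable n := by
  induction h with
  | base D hc hD =>
    rintro ⟨φ, hφ⟩
    obtain ⟨x, hx, y, hy, hne, hxy⟩ := Finset.exists_ne_map_eq_of_card_lt_of_maps_to
      (s := D.verts) (t := (Finset.univ : Finset (Fin n))) (by simpa [hc] using hn)
      (f := φ) (fun _ _ => by simp)
    have h1 : (x, y) ∈ D.arcs := by rw [hD]; simp [hx, hy, hne]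
    have h2 : (y, x) ∈ D.arcs := by rw [hD]; simp [hx, hy, hne.symm]
    exact hφ x (.tail (.single ⟨h1, hxy⟩) ⟨h2, hxy.symm⟩)
  | dirJoin D D1 D2 u1 v1 v2 u2 _ _ hj ih1 ih2 =>
    rintro ⟨φ, hφ⟩
    obtain ⟨H, A1, ι, ⟨hdisj, hu1, hu2, hHv, hHa⟩, hA1, hA2, hinj, hιu, hDv, hDa⟩ := hj
    set F : ℕ → ℕ := fun x => if x ∈ A1 then ι x else x with hF
    set g : ℕ → ℕ := fun x => if x = v2 then v1 else x with hg
    have hH : ∀ x y, (x, y) ∈ H.arcs → (F x, F y) ∈ D.arcs := by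
      intro x y hxy
      rw [hDa]
      exact Finset.mem_image.mpr ⟨(x, y), hxy, rfl⟩
    have p1 := half_dir F u1 v1 ih1 hφ (fun x y hxy hne => hH x y (by
      rw [hHa]; simp only [Finset.mem_union]
      exact Or.inl (Or.inl (Finset.mem_erase.mpr ⟨hne, hxy⟩))))
    have p2 := half_dir (F ∘ g) v2 u2 ih2 hφ (fun x y hxy hne => hH (g x) (g y) (by
      rw [hHa]; simp only [Finset.mem_union]
      exact Or.inl (Or.inr (Finset.mem_image.mpr
        ⟨(x, y), Finset.mem_erase.mpr ⟨hne, hxy⟩, rfl⟩))))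
    have hne : u2 ≠ v2 := fun h => D2.no_loops _ hu2 h.symm
    have hg1 : g v2 = v1 := by simp [hg]
    have hg2 : g u2 = u2 := by simp [hg, hne]
    simp only [Function.comp, hg1, hg2] at p2
    have harc : (F u1, F u2) ∈ D.arcs := hH _ _ (by rw [hHa]; simp)
    refine hφ (F u1) (Relation.TransGen.head' ⟨harc, p1.1.trans p2.1⟩ (p2.2.trans p1.2))
  | bidirJoin D D1 D2 u1 v1 v2 u2 _ _ hj ih1 ih2 =>
    rintro ⟨φ, hφ⟩
    obtain ⟨H, A1, ι, ⟨hdisj, hu1, hu1', hu2', hu2, hHv, hHa⟩, hA1, hA2, hinj, hιu,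
      hDv, hDa⟩ := hj
    set F : ℕ → ℕ := fun x => if x ∈ A1 then ι x else x with hF
    set g : ℕ → ℕ := fun x => if x = v2 then v1 else x with hg
    have hH : ∀ x y, (x, y) ∈ H.arcs → (F x, F y) ∈ D.arcs := by
      intro x y hxy
      rw [hDa]
      exact Finset.mem_image.mpr ⟨(x, y), hxy, rfl⟩
    have p1 := half_bidir F u1 v1 ih1 hφ (fun x y hxy hne hne' => hH x y (by
      rw [hHa]; simp only [Finset.mem_union]
      exact Or.inl (Or.inl (Finset.mem_erase.mpr ⟨hne', Finset.mem_erase.mpr ⟨hne, hxy⟩⟩))))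
    have p2 := half_bidir (F ∘ g) v2 u2 ih2 hφ (fun x y hxy hne hne' => hH (g x) (g y) (by
      rw [hHa]; simp only [Finset.mem_union]
      exact Or.inl (Or.inr (Finset.mem_image.mpr
        ⟨(x, y), Finset.mem_erase.mpr ⟨hne', Finset.mem_erase.mpr ⟨hne, hxy⟩⟩, rfl⟩))))
    have hne : u2 ≠ v2 := fun h => D2.no_loops _ hu2 h.symm
    have hg1 : g v2 = v1 := by simp [hg]
    have hg2 : g u2 = u2 := by simp [hg, hne]
    simp only [Function.comp, hg1, hg2] at p2
    have harc : (F u1, F u2) ∈ D.arcs := hH _ _ (by rw [hHa]; simp)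
    have harc' : (F u2, F u1) ∈ D.arcs := hH _ _ (by rw [hHa]; simp)
    have hc := p1.trans p2
    exact hφ (F u1) (.tail (.single ⟨harc, hc⟩) ⟨harc', hc.symm⟩)
  | iso D D' _ hiso ih =>
    intro hc
    obtain ⟨f, hf, hfa⟩ := hiso
    refine ih (colorable_of_hom f (fun x y hxy => ?_) hc)
    have := D.arcs_sub _ hxy
    exact (hfa x this.1 y this.2).mp hxy

/-- The isomorphic copy of `D` under an injective renaming. -/
def rename (D : Digr) (f : ℕ → ℕ) (hf : Set.InjOn f (D.verts : Set ℕ)) : Digr where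
  verts := D.verts.image f
  arcs := D.arcs.image (Prod.map f f)
  arcs_sub := by
    intro a ha
    obtain ⟨b, hb, rfl⟩ := Finset.mem_image.mp ha
    have := D.arcs_sub b hb
    exact ⟨Finset.mem_image_of_mem f this.1, Finset.mem_image_of_mem f this.2⟩
  no_loops := by
    intro a ha
    obtain ⟨b, hb, rfl⟩ := Finset.mem_image.mp ha
    have := D.arcs_sub b hb
    exact fun h => D.no_loops b hb (hf this.1 this.2 h)

theorem rename_arc_iff (D : Digr) (f : ℕ → ℕ) (hf : Set.InjOn f (D.verts : Set ℕ))
    {x y : ℕ} (hx : x ∈ D.verts) (hy : y ∈ D.verts) :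
    (f x, f y) ∈ (D.rename f hf).arcs ↔ (x, y) ∈ D.arcs := by
  constructor
  · intro h
    obtain ⟨⟨a, b⟩, hab, he⟩ := Finset.mem_image.mp h
    have hs := D.arcs_sub _ hab
    obtain ⟨h1, h2⟩ := Prod.mk.inj he
    rw [← hf hs.1 hx h1, ← hf hs.2 hy h2]
    exact hab
  · intro h
    exact Finset.mem_image.mpr ⟨(x, y), h, rfl⟩

theorem oreConstr_rename {k : ℕ} {D : Digr} (h : OreConstr k D) (f : ℕ → ℕ)
    (hf : Set.InjOn f (D.verts : Set ℕ)) : OreConstr k (D.rename f hf) := by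
  refine .iso D _ h ⟨f, ⟨?_, hf, ?_⟩, ?_⟩
  · intro x hx
    exact Finset.mem_coe.mpr (Finset.mem_image_of_mem f hx)
  · intro y hy
    obtain ⟨x, hx, h⟩ := Finset.mem_image.mp (Finset.mem_coe.mp hy)
    exact ⟨x, hx, h⟩
  · intro x hx y hy
    exact (D.rename_arc_iff f hf hx hy).symm

/-- The union of `H1 - uv`, `H2 - vw` and the arc `uw` is Ore-constructible. -/
theorem oreConstr_union {k : ℕ} {H1 H2 T : Digr} (h1 : OreConstr k H1) (h2 : OreConstr k H2)
    {u v w : ℕ} (huw : u ≠ w) (huv1 : (u, v) ∈ H1.arcs) (hvw2 : (v, w) ∈ H2.arcs)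
    (hTv : T.verts = H1.verts ∪ H2.verts)
    (hTa : T.arcs = H1.arcs.erase (u, v) ∪ H2.arcs.erase (v, w) ∪ {(u, w)}) :
    OreConstr k T := by
  obtain ⟨N, hN1, hN2⟩ : ∃ N, (∀ x ∈ H1.verts, x < N) ∧ ∀ x ∈ H2.verts, x < N := by
    refine ⟨(H1.verts ∪ H2.verts).sup id + 1, fun x hx => ?_, fun x hx => ?_⟩
    · exact Nat.lt_succ_of_le (Finset.le_sup (f := id) (Finset.mem_union_left _ hx))
    · exact Nat.lt_succ_of_le (Finset.le_sup (f := id) (Finset.mem_union_right _ hx))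
  have hu1 := (H1.arcs_sub _ huv1).1
  have hv1 := (H1.arcs_sub _ huv1).2
  have hv2 := (H2.arcs_sub _ hvw2).1
  have hw2 := (H2.arcs_sub _ hvw2).2
  have huv : u ≠ v := H1.no_loops _ huv1
  have hvw : v ≠ w := H2.no_loops _ hvw2
  simp only at hu1 hv1 hv2 hw2
  let s1 : ℕ → ℕ := fun x => if x ∈ H2.verts ∧ x ≠ v then x + N + 1 else x
  let s2 : ℕ → ℕ := fun x => if x = v then N else x
  have hs1 : Set.InjOn s1 (H1.verts : Set ℕ) := by
    intro x hx y hy hxy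
    have := hN1 x hx
    have := hN1 y hy
    simp only [s1] at hxy
    split_ifs at hxy <;> omega
  have hs2 : Set.InjOn s2 (H2.verts : Set ℕ) := by
    intro x hx y hy hxy
    have := hN2 x hx
    have := hN2 y hy
    simp only [s2] at hxy
    split_ifs at hxy <;> omega
  let A1 : Finset ℕ := ((H1.verts ∩ H2.verts).erase v).image (fun x => x + N + 1)
  let ι : ℕ → ℕ := fun x => x - (N + 1)
  let g : ℕ → ℕ := fun x => if x = N then v else x
  let F : ℕ → ℕ := fun x => if x ∈ A1 then ι x else x
  have hA1N : ∀ x ∈ A1, N < x := by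
    intro x hx
    obtain ⟨y, _, rfl⟩ := Finset.mem_image.mp hx
    show N < y + N + 1
    omega
  have hFs1 : ∀ x ∈ H1.verts, F (s1 x) = x := by
    intro x hx
    have hxN := hN1 x hx
    by_cases hc : x ∈ H2.verts ∧ x ≠ v
    · have e : s1 x = x + N + 1 := if_pos hc
      have hm : x + N + 1 ∈ A1 := Finset.mem_image.mpr
        ⟨x, Finset.mem_erase.mpr ⟨hc.2, Finset.mem_inter.mpr ⟨hx, hc.1⟩⟩, rfl⟩
      simp only [F, e, hm, if_true, ι]
      omega
    · have e : s1 x = x := by simp only [s1, hc, if_false]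
      have hm : x ∉ A1 := fun h => by have := hA1N x h; omega
      simp only [F, e, hm, if_false]
  have hgs2 : ∀ x ∈ H2.verts, g (s2 x) = x := by
    intro x hx
    have hxN := hN2 x hx
    simp only [g, s2]
    split_ifs <;> omega
  have hF2 : ∀ x ∈ H2.verts, F x = x := by
    intro x hx
    have hxN := hN2 x hx
    have hm : x ∉ A1 := fun h => by have := hA1N x h; omega
    simp only [F, hm, if_false]
  have hs1v : s1 v = v := by simp [s1]
  have hs2v : s2 v = N := by simp [s2]
  have hs2w : s2 w = w := by simp [s2, hvw.symm]
  have himg1 : ∀ (A : Finset (ℕ × ℕ)), A ⊆ H1.arcs →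
      (A.image (Prod.map s1 s1)).image (Prod.map F F) = A := by
    intro A hA
    rw [Finset.image_image]
    conv_rhs => rw [← Finset.image_id (s := A)]
    apply Finset.image_congr
    rintro ⟨x, y⟩ hxy
    have := H1.arcs_sub _ (hA hxy)
    simp [hFs1 x this.1, hFs1 y this.2]
  have himg2 : ∀ (A : Finset (ℕ × ℕ)), A ⊆ H2.arcs →
      ((A.image (Prod.map s2 s2)).image (Prod.map g g)) = A := by
    intro A hA
    rw [Finset.image_image]
    conv_rhs => rw [← Finset.image_id (s := A)]
    apply Finset.image_congr
    rintro ⟨x, y⟩ hxy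
    have := H2.arcs_sub _ (hA hxy)
    simp [hgs2 x this.1, hgs2 y this.2]
  have himg2' : ∀ (A : Finset (ℕ × ℕ)), A ⊆ H2.arcs → A.image (Prod.map F F) = A := by
    intro A hA
    conv_rhs => rw [← Finset.image_id (s := A)]
    apply Finset.image_congr
    rintro ⟨x, y⟩ hxy
    have := H2.arcs_sub _ (hA hxy)
    simp [hF2 x this.1, hF2 y this.2]
  have herase : ∀ (K : Digr) (s : ℕ → ℕ), Set.InjOn s (K.verts : Set ℕ) → ∀ a b,
      (a, b) ∈ K.arcs → (K.arcs.image (Prod.map s s)).erase (s a, s b) =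
        (K.arcs.erase (a, b)).image (Prod.map s s) := by
    intro K s hs a b hab
    have hab' := K.arcs_sub _ hab
    ext ⟨p, q⟩
    simp only [Finset.mem_erase, Finset.mem_image]
    constructor
    · rintro ⟨hne, ⟨x, y⟩, hxy, he⟩
      refine ⟨(x, y), ⟨?_, hxy⟩, he⟩
      intro h
      obtain ⟨rfl, rfl⟩ := Prod.mk.inj h
      exact hne he.symm
    · rintro ⟨⟨x, y⟩, ⟨hne, hxy⟩, he⟩
      refine ⟨?_, (x, y), hxy, he⟩
      intro h
      rw [h] at he
      have hxy' := K.arcs_sub _ hxy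
      obtain ⟨e1, e2⟩ := Prod.mk.inj he
      exact hne (Prod.ext (hs hxy'.1 hab'.1 e1) (hs hxy'.2 hab'.2 e2))
  have hmem1 : ∀ x ∈ H1.verts, s1 x < N ∧ s1 x = x ∨ N < s1 x := by
    intro x hx
    have := hN1 x hx
    simp only [s1]
    split_ifs <;> omega
  have hs1u_ne : s1 u ≠ w := by
    simp only [s1]
    have := hN2 w hw2
    split_ifs <;> omega
  -- the Hajos join
  let HJ : Digr :=
    { verts := (H1.rename s1 hs1).verts ∪ (H2.rename s2 hs2).verts.erase N
      arcs := (H1.rename s1 hs1).arcs.erase (s1 u, v) ∪ H2.arcs.erase (v, w) ∪ {(s1 u, w)}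
      arcs_sub := by
        have hsub2 : ∀ x ∈ H2.verts,
            x ∈ (H1.rename s1 hs1).verts ∪ (H2.rename s2 hs2).verts.erase N := by
          intro x hx
          by_cases hxv : x = v
          · refine Finset.mem_union_left _ (Finset.mem_image.mpr ⟨v, hv1, ?_⟩)
            rw [hs1v, hxv]
          · have := hN2 x hx
            refine Finset.mem_union_right _ (Finset.mem_erase.mpr ⟨by omega, ?_⟩)
            refine Finset.mem_image.mpr ⟨x, hx, ?_⟩
            simp [s2, hxv]
        intro a ha
        simp only [Finset.mem_union, Finset.mem_singleton] at ha
        rcases ha with (ha | ha) | rfl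
        · have := (H1.rename s1 hs1).arcs_sub a (Finset.mem_of_mem_erase ha)
          exact ⟨Finset.mem_union_left _ this.1, Finset.mem_union_left _ this.2⟩
        · have := H2.arcs_sub a (Finset.mem_of_mem_erase ha)
          exact ⟨hsub2 _ this.1, hsub2 _ this.2⟩
        · exact ⟨Finset.mem_union_left _ (Finset.mem_image_of_mem s1 hu1), hsub2 w hw2⟩
      no_loops := by
        intro a ha
        simp only [Finset.mem_union, Finset.mem_singleton] at ha
        rcases ha with (ha | ha) | rfl
        · exact (H1.rename s1 hs1).no_loops a (Finset.mem_of_mem_erase ha)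
        · exact H2.no_loops a (Finset.mem_of_mem_erase ha)
        · exact hs1u_ne }
  refine .dirJoin T (H1.rename s1 hs1) (H2.rename s2 hs2) (s1 u) v N w
    (oreConstr_rename h1 s1 hs1) (oreConstr_rename h2 s2 hs2)
    ⟨HJ, A1, ι, ⟨?_, ?_, ?_, rfl, ?_⟩, ?_, ?_, ?_, ?_, ?_, ?_⟩
  · rw [Finset.disjoint_left]
    intro z hz hz'
    obtain ⟨x, hx, rfl⟩ := Finset.mem_image.mp hz
    obtain ⟨y, hy, hxy⟩ := Finset.mem_image.mp hz'
    have := hN1 x hx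
    have := hN2 y hy
    simp only [s1, s2] at hxy
    split_ifs at hxy with c1 c2 c2
    · omega
    · omega
    · omega
    · exact c2 ⟨hxy ▸ hy, fun h => c1 (hxy.trans h)⟩
  · have := (H1.rename_arc_iff s1 hs1 hu1 hv1).mpr huv1
    rwa [hs1v] at this
  · have := (H2.rename_arc_iff s2 hs2 hv2 hw2).mpr hvw2
    rwa [hs2v, hs2w] at this
  · have e := herase H2 s2 hs2 v w hvw2
    rw [hs2v, hs2w] at e
    show (H1.rename s1 hs1).arcs.erase (s1 u, v) ∪ H2.arcs.erase (v, w) ∪ {(s1 u, w)} =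
      (H1.rename s1 hs1).arcs.erase (s1 u, v) ∪
        ((H2.arcs.image (Prod.map s2 s2)).erase (N, w)).image (Prod.map g g) ∪ {(s1 u, w)}
    rw [e, himg2 _ (Finset.erase_subset _ _)]
  · intro z hz
    obtain ⟨x, hx, rfl⟩ := Finset.mem_image.mp hz
    obtain ⟨hxv, hx⟩ := Finset.mem_erase.mp hx
    obtain ⟨hx1, hx2⟩ := Finset.mem_inter.mp hx
    have := hN1 v hv1
    refine Finset.mem_erase.mpr ⟨by omega, Finset.mem_image.mpr ⟨x, hx1, ?_⟩⟩
    simp [s1, hx2, hxv]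
  · intro z hz
    obtain ⟨z', hz', rfl⟩ := Finset.mem_image.mp hz
    obtain ⟨x, hx, rfl⟩ := Finset.mem_image.mp hz'
    obtain ⟨hxv, hx⟩ := Finset.mem_erase.mp hx
    obtain ⟨hx1, hx2⟩ := Finset.mem_inter.mp hx
    have := hN2 x hx2
    have e : ι (x + N + 1) = x := by simp only [ι]; omega
    simp only [e]
    refine Finset.mem_erase.mpr ⟨by omega, Finset.mem_image.mpr ⟨x, hx2, ?_⟩⟩
    simp [s2, hxv]
  · intro x hx y hy hxy
    have := hA1N x hx
    have := hA1N y hy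
    simp only [ι] at hxy
    omega
  · intro hu hw
    have := hFs1 u hu1
    simp only [F, hu, if_true] at this
    exact huw (this.symm.trans hw)
  · show T.verts = ((H1.verts.image s1) ∪ (H2.verts.image s2).erase N).image F
    rw [hTv]
    ext z
    simp only [Finset.mem_union, Finset.mem_image, Finset.mem_erase]
    constructor
    · rintro (hz | hz)
      · exact ⟨s1 z, Or.inl ⟨z, hz, rfl⟩, hFs1 z hz⟩
      · by_cases hzv : z = v
        · subst hzv
          exact ⟨s1 z, Or.inl ⟨z, hv1, rfl⟩, hFs1 z hv1⟩
        · have := hN2 z hz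
          refine ⟨z, Or.inr ⟨by omega, z, hz, ?_⟩, hF2 z hz⟩
          simp [s2, hzv]
    · rintro ⟨y, ⟨x, hx, rfl⟩ | ⟨hyN, x, hx, rfl⟩, rfl⟩
      · left; rw [hFs1 x hx]; exact hx
      · right
        have hxv : x ≠ v := by rintro rfl; exact hyN hs2v
        have e : s2 x = x := by simp [s2, hxv]
        rw [e, hF2 x hx]; exact hx
  · show T.arcs = ((H1.arcs.image (Prod.map s1 s1)).erase (s1 u, v) ∪ H2.arcs.erase (v, w) ∪
      {(s1 u, w)}).image (Prod.map F F)
    have e := herase H1 s1 hs1 u v huv1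
    rw [hs1v] at e
    rw [hTa, Finset.image_union, Finset.image_union, e, himg1 _ (Finset.erase_subset _ _),
      himg2' _ (Finset.erase_subset _ _), Finset.image_singleton]
    simp only [Prod.map, hFs1 u hu1, hF2 w hw2]

/-- Adding an arc. -/
def addArc (D : Digr) (u v : ℕ) (hu : u ∈ D.verts) (hv : v ∈ D.verts) (h : u ≠ v) : Digr where
  verts := D.verts
  arcs := insert (u, v) D.arcs
  arcs_sub := by
    intro a ha
    rcases Finset.mem_insert.mp ha with rfl | ha
    · exact ⟨hu, hv⟩
    · exact D.arcs_sub a ha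
  no_loops := by
    intro a ha
    rcases Finset.mem_insert.mp ha with rfl | ha
    · exact h
    · exact D.no_loops a ha

/-- Case where the non-arc relation is transitive: Dilworth's theorem applies. -/
theorem exists_of_transitive {k : ℕ} (hk : 3 ≤ k) (D : Digr) (hD : ¬ D.Colorable (k - 1))
    (htr : ∀ u ∈ D.verts, ∀ v ∈ D.verts, ∀ w ∈ D.verts, u ≠ v → v ≠ w → u ≠ w →
      (u, v) ∉ D.arcs → (v, w) ∉ D.arcs → (u, w) ∉ D.arcs) :
    ∃ H : Digr, H.Sub D ∧ OreConstr k H := by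
  let P : Preorder ℕ :=
    { le := fun x y => x = y ∨ (x ∈ D.verts ∧ y ∈ D.verts ∧ (x, y) ∉ D.arcs)
      lt := fun x y => (x = y ∨ (x ∈ D.verts ∧ y ∈ D.verts ∧ (x, y) ∉ D.arcs)) ∧
        ¬ (y = x ∨ (y ∈ D.verts ∧ x ∈ D.verts ∧ (y, x) ∉ D.arcs))
      lt_iff_le_not_ge := fun _ _ => Iff.rfl
      le_refl := fun x => Or.inl rfl
      le_trans := by
        rintro x y z (rfl | ⟨hx, hy, hxy⟩) (rfl | ⟨hy', hz, hyz⟩)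
        · exact Or.inl rfl
        · exact Or.inr ⟨hy', hz, hyz⟩
        · exact Or.inr ⟨hx, hy, hxy⟩
        · by_cases h1 : x = y
          · subst h1; exact Or.inr ⟨hx, hz, hyz⟩
          by_cases h2 : y = z
          · subst h2; exact Or.inr ⟨hx, hy, hxy⟩
          by_cases h3 : x = z
          · exact Or.inl h3
          exact Or.inr ⟨hx, hz, htr x hx y hy z hz h1 h2 h3 hxy hyz⟩ }
  obtain ⟨m, ⟨T, hTS, hTm, hT⟩, φ, hφ, hch⟩ := @dilworth_aux ℕ _ P _ D.verts rfl
  have hT' : ∀ x ∈ T, ∀ y ∈ T, x ≠ y →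
      ¬ (x = y ∨ (x ∈ D.verts ∧ y ∈ D.verts ∧ (x, y) ∉ D.arcs)) := hT
  have hch' : ∀ x ∈ D.verts, ∀ y ∈ D.verts, φ x = φ y →
      (x = y ∨ (x ∈ D.verts ∧ y ∈ D.verts ∧ (x, y) ∉ D.arcs)) ∨
      (y = x ∨ (y ∈ D.verts ∧ x ∈ D.verts ∧ (y, x) ∉ D.arcs)) := hch
  by_cases hmk : k ≤ m
  · obtain ⟨B, hBT, hBk⟩ := Finset.exists_subset_card_eq (hTm.symm ▸ hmk : k ≤ T.card)
    let H : Digr :=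
      { verts := B
        arcs := (B ×ˢ B).filter (fun a => a.1 ≠ a.2)
        arcs_sub := fun a ha => Finset.mem_product.mp (Finset.mem_filter.mp ha).1
        no_loops := fun a ha => (Finset.mem_filter.mp ha).2 }
    refine ⟨H, ⟨hBT.trans hTS, ?_⟩, .base H hBk rfl⟩
    rintro ⟨x, y⟩ hxy
    obtain ⟨hxy, hne⟩ := Finset.mem_filter.mp hxy
    obtain ⟨hx, hy⟩ := Finset.mem_product.mp hxy
    have := hT' x (hBT hx) y (hBT hy) hne
    by_contra hc
    exact this (Or.inr ⟨hTS (hBT hx), hTS (hBT hy), hc⟩)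
  · exfalso
    push Not at hmk
    apply hD
    refine ⟨fun x => ⟨φ x % (k - 1), Nat.mod_lt _ (by omega)⟩, fun v hv => ?_⟩
    have hlt : ∀ x y : ℕ, Relation.TransGen (fun x y => (x, y) ∈ D.arcs ∧
        (⟨φ x % (k - 1), Nat.mod_lt _ (by omega)⟩ : Fin (k - 1)) =
          ⟨φ y % (k - 1), Nat.mod_lt _ (by omega)⟩) x y → P.lt y x := by
      intro x y hxy
      have step : ∀ x y : ℕ, (x, y) ∈ D.arcs ∧
        (⟨φ x % (k - 1), Nat.mod_lt _ (by omega)⟩ : Fin (k - 1)) =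
          ⟨φ y % (k - 1), Nat.mod_lt _ (by omega)⟩ → P.lt y x := by
        rintro x y ⟨ha, hc⟩
        have hs := D.arcs_sub _ ha
        have hne := D.no_loops _ ha
        simp only at hs hne
        have e1 := hφ x hs.1
        have e2 := hφ y hs.2
        have hc' : φ x % (k - 1) = φ y % (k - 1) := congrArg Fin.val hc
        rw [Nat.mod_eq_of_lt (by omega), Nat.mod_eq_of_lt (by omega)] at hc'
        have hnot : ¬ P.le x y := by
          rintro (h | ⟨_, _, h⟩)
          · exact hne h
          · exact h ha
        refine P.lt_iff_le_not_ge y x |>.mpr ⟨?_, hnot⟩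
        rcases hch' x hs.1 y hs.2 hc' with h | h
        · exact absurd h hnot
        · exact h
      induction hxy with
      | single h => exact step _ _ h
      | tail _ h ih => exact @lt_trans ℕ P _ _ _ (step _ _ h) ih
    exact @lt_irrefl ℕ P v (hlt v v hv)

theorem exists_oreConstr {k : ℕ} (hk : 3 ≤ k) (n : ℕ) :
    ∀ D : Digr, ((D.verts ×ˢ D.verts) \ D.arcs).card = n → ¬ D.Colorable (k - 1) →
      ∃ H : Digr, H.Sub D ∧ OreConstr k H := by
  induction n using Nat.strong_induction_on with
  | _ n ih =>
  intro D hn hD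
  by_cases htr : ∀ u ∈ D.verts, ∀ v ∈ D.verts, ∀ w ∈ D.verts, u ≠ v → v ≠ w → u ≠ w →
      (u, v) ∉ D.arcs → (v, w) ∉ D.arcs → (u, w) ∉ D.arcs
  · exact exists_of_transitive hk D hD htr
  push Not at htr
  obtain ⟨u, hu, v, hv, w, hw, huv, hvw, huw, hnuv, hnvw, hauw⟩ := htr
  have key : ∀ a b (ha : a ∈ D.verts) (hb : b ∈ D.verts) (hab : a ≠ b), (a, b) ∉ D.arcs →
      ∃ H : Digr, H.Sub (D.addArc a b ha hb hab) ∧ OreConstr k H := by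
    intro a b ha hb hab hnab
    refine ih _ ?_ (D.addArc a b ha hb hab) rfl ?_
    · rw [← hn]
      apply Finset.card_lt_card
      refine ⟨?_, fun h => ?_⟩
      · exact Finset.sdiff_subset_sdiff le_rfl (Finset.subset_insert _ _)
      · have := h (Finset.mem_sdiff.mpr ⟨Finset.mem_product.mpr ⟨ha, hb⟩, hnab⟩)
        exact (Finset.mem_sdiff.mp this).2 (Finset.mem_insert_self _ _)
    · intro hc
      exact hD (colorable_of_hom id (fun x y hxy => Finset.mem_insert_of_mem hxy) hc)
  obtain ⟨H1, hH1, hO1⟩ := key u v hu hv huv hnuv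
  obtain ⟨H2, hH2, hO2⟩ := key v w hv hw hvw hnvw
  by_cases c1 : (u, v) ∈ H1.arcs
  swap
  · exact ⟨H1, ⟨hH1.1, fun a ha => Finset.mem_of_mem_insert_of_ne (hH1.2 ha)
      (by rintro rfl; exact c1 ha)⟩, hO1⟩
  by_cases c2 : (v, w) ∈ H2.arcs
  swap
  · exact ⟨H2, ⟨hH2.1, fun a ha => Finset.mem_of_mem_insert_of_ne (hH2.2 ha)
      (by rintro rfl; exact c2 ha)⟩, hO2⟩
  let T : Digr :=
    { verts := H1.verts ∪ H2.verts
      arcs := H1.arcs.erase (u, v) ∪ H2.arcs.erase (v, w) ∪ {(u, w)}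
      arcs_sub := by
        intro a ha
        simp only [Finset.mem_union, Finset.mem_singleton] at ha
        rcases ha with (ha | ha) | rfl
        · have := H1.arcs_sub a (Finset.mem_of_mem_erase ha)
          exact ⟨Finset.mem_union_left _ this.1, Finset.mem_union_left _ this.2⟩
        · have := H2.arcs_sub a (Finset.mem_of_mem_erase ha)
          exact ⟨Finset.mem_union_right _ this.1, Finset.mem_union_right _ this.2⟩
        · exact ⟨Finset.mem_union_left _ (H1.arcs_sub _ c1).1,
            Finset.mem_union_right _ (H2.arcs_sub _ c2).2⟩
      no_loops := by
        intro a ha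
        simp only [Finset.mem_union, Finset.mem_singleton] at ha
        rcases ha with (ha | ha) | rfl
        · exact H1.no_loops a (Finset.mem_of_mem_erase ha)
        · exact H2.no_loops a (Finset.mem_of_mem_erase ha)
        · exact huw }
  refine ⟨T, ⟨Finset.union_subset hH1.1 hH2.1, ?_⟩,
    oreConstr_union hO1 hO2 huw c1 c2 rfl rfl⟩
  intro a ha
  have ha' : a ∈ H1.arcs.erase (u, v) ∪ H2.arcs.erase (v, w) ∪ {(u, w)} := ha
  simp only [Finset.mem_union, Finset.mem_singleton] at ha'
  rcases ha' with (ha | ha) | rfl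
  · obtain ⟨hne, ha⟩ := Finset.mem_erase.mp ha
    exact Finset.mem_of_mem_insert_of_ne (hH1.2 ha) hne
  · obtain ⟨hne, ha⟩ := Finset.mem_erase.mp ha
    exact Finset.mem_of_mem_insert_of_ne (hH2.2 ha) hne
  · exact hauw

theorem colorable_nonempty (D : Digr) : {n | D.Colorable n}.Nonempty := by
  refine ⟨D.verts.sup id + 1, fun x => ⟨x % (D.verts.sup id + 1), Nat.mod_lt _ (by omega)⟩, ?_⟩
  intro v hv
  have hno : ∀ x y : ℕ, ¬ ((x, y) ∈ D.arcs ∧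
      (⟨x % (D.verts.sup id + 1), Nat.mod_lt _ (by omega)⟩ : Fin (D.verts.sup id + 1)) =
        ⟨y % (D.verts.sup id + 1), Nat.mod_lt _ (by omega)⟩) := by
    rintro x y ⟨ha, hc⟩
    have hs := D.arcs_sub _ ha
    have hc' : x % (D.verts.sup id + 1) = y % (D.verts.sup id + 1) := congrArg Fin.val hc
    have e1 : x ≤ D.verts.sup id := Finset.le_sup (f := id) hs.1
    have e2 : y ≤ D.verts.sup id := Finset.le_sup (f := id) hs.2
    rw [Nat.mod_eq_of_lt (by omega), Nat.mod_eq_of_lt (by omega)] at hc'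
    exact D.no_loops _ ha hc'
  cases hv with
  | single h => exact hno _ _ h
  | tail _ h => exact hno _ _ h

end Digr

open Digr in
/-- For `k ≥ 3`, a digraph `D` has dichromatic number at least `k`
iff it contains an Ore-`k`-constructible subdigraph. -/
theorem dichromatic_ge_iff_oreConstructible_subdigraph (k : ℕ) (hk : 3 ≤ k)
    (D : Digr) :
    k ≤ D.dichrom ↔ ∃ H : Digr, H.Sub D ∧ OreConstr k H := by
  constructor
  · intro h
    refine exists_oreConstr hk _ D rfl (fun hc => ?_)
    have : D.dichrom ≤ k - 1 := Nat.sInf_le hc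
    omega
  · rintro ⟨H, hH, hO⟩
    by_contra hlt
    push Not at hlt
    have hc : D.Colorable D.dichrom := Nat.sInf_mem D.colorable_nonempty
    exact oreConstr_not_colorable hlt hO (colorable_of_hom id (fun x y hxy => hH.2 hxy) hc)
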